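/- arXiv:2512.17382 — 8 statements merged into one kernel-verified Lean document; each statement's English description precedes it below -/
import Mathlib

section
/- Let d ≥ 1 and let K be a nonempty bounded subset of the Euclidean space ℝ^d. Then there exists a point c ∈ ℝ^d such that K is contained in the closed ball of center c and radius √(d/(2(d+1))) · diam(K). Equivalently, δ(K) ≤ 2·meb(K) ≤ √(2d/(d+1)) · δ(K), where the left inequality is the trivial bound and the right inequality is Jung's bound. -/
open Finset in
/-- Finite version in an inner product space, via maximising the variance over the simplex. -/
lemma jung_finite {E : Type*} [NormedAddCommGroup E] [InnerProductSpace ℝ E]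
    {ι : Type*} [Fintype ι] [Nonempty ι] (x : ι → E) (D : ℝ) (hD : 0 ≤ D)
    (hx : ∀ i j, dist (x i) (x j) ≤ D) :
    ∃ c : E, ∀ j, ‖x j - c‖ ^ 2 ≤ (1 - 1 / (Fintype.card ι : ℝ)) / 2 * D ^ 2 := by
  classical
  let φ : (ι → ℝ) → ℝ := fun w => ∑ i, w i * ‖x i‖ ^ 2 - ‖∑ i, w i • x i‖ ^ 2
  have hφc : Continuous φ := by fun_prop
  obtain ⟨w, hw, hmax⟩ := (isCompact_stdSimplex ℝ ι).exists_isMaxOn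
    ⟨_, single_mem_stdSimplex ℝ (Classical.arbitrary ι)⟩ hφc.continuousOn
  obtain ⟨hw0, hw1⟩ := hw
  set c := ∑ i, w i • x i with hc
  set S := ∑ i, w i * ‖x i‖ ^ 2 with hS
  have hφw : φ w = S - ‖c‖ ^ 2 := rfl
  refine ⟨c, fun j => ?_⟩
  have hbound : φ w ≤ (1 - 1 / (Fintype.card ι : ℝ)) / 2 * D ^ 2 := by
    have h1 : ∑ i, ∑ k, w i * w k * ‖x i - x k‖ ^ 2 = 2 * φ w := by
      have hcc : ‖c‖ ^ 2 = ∑ i, ∑ k, w i * w k * inner ℝ (x i) (x k) := by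
        rw [← real_inner_self_eq_norm_sq, hc, sum_inner]
        refine sum_congr rfl fun i _ => ?_
        rw [inner_sum]
        refine sum_congr rfl fun k _ => ?_
        rw [real_inner_smul_left, real_inner_smul_right]; ring
      have hA : ∑ i, ∑ k, w i * w k * ‖x i‖ ^ 2 = S := by
        rw [hS]
        refine sum_congr rfl fun i _ => ?_
        rw [← sum_mul, ← mul_sum, hw1, mul_one]
      have hB : ∑ i, ∑ k, w i * w k * ‖x k‖ ^ 2 = S := by
        rw [sum_comm, ← hA]
        refine sum_congr rfl fun i _ => sum_congr rfl fun k _ => by ring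
      have : ∑ i, ∑ k, w i * w k * ‖x i - x k‖ ^ 2 =
          ∑ i, ∑ k, w i * w k * ‖x i‖ ^ 2 + ∑ i, ∑ k, w i * w k * ‖x k‖ ^ 2
            - 2 * ∑ i, ∑ k, w i * w k * inner ℝ (x i) (x k) := by
        simp only [mul_sum, ← sum_add_distrib, ← sum_sub_distrib]
        refine sum_congr rfl fun i _ => sum_congr rfl fun k _ => ?_
        rw [norm_sub_sq_real]; ring
      rw [this, hA, hB, ← hcc, hφw]; ring
    have h2 : ∑ i, ∑ k, w i * w k * ‖x i - x k‖ ^ 2 ≤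
        ∑ i, ∑ k, (w i * w k - if i = k then w i * w k else 0) * D ^ 2 := by
      refine sum_le_sum fun i _ => sum_le_sum fun k _ => ?_
      split_ifs with h
      · subst h; simp
      · rw [sub_zero]
        have := hx i k
        rw [dist_eq_norm] at this
        have := hw0 i
        have := hw0 k
        gcongr
    have h3 : ∑ i, ∑ k, (w i * w k - if i = k then w i * w k else 0) * D ^ 2
        = (1 - ∑ i, w i ^ 2) * D ^ 2 := by
      simp only [← sum_mul, sum_sub_distrib, ← mul_sum, hw1, sum_ite_eq, mem_univ, if_true,
        mul_one, sq]
    have h4 : 1 / (Fintype.card ι : ℝ) ≤ ∑ i, w i ^ 2 := by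
      have := sq_sum_le_card_mul_sum_sq (s := (univ : Finset ι)) (f := w)
      rw [hw1, card_univ] at this
      rw [div_le_iff₀ (by exact_mod_cast Fintype.card_pos)]
      linarith
    nlinarith [mul_le_mul_of_nonneg_right h4 (sq_nonneg D)]
  refine le_trans ?_ hbound
  set a := ‖x j - c‖ ^ 2 with ha
  have key : ∀ t : ℝ, 0 < t → t ≤ 1 → a - φ w ≤ t * a := by
    intro t ht0 ht1
    let v : ι → ℝ := fun i => (1 - t) * w i + t * (if i = j then 1 else 0)
    have hv : v ∈ stdSimplex ℝ ι := by
      refine ⟨fun i => ?_, ?_⟩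
      · have := hw0 i
        have : 0 ≤ 1 - t := by linarith
        simp only [v]; split_ifs <;> positivity
      · simp only [v, sum_add_distrib, ← mul_sum, hw1, sum_ite_eq', mem_univ, if_true]; ring
    have hle : φ v ≤ φ w := hmax hv
    have e1 : ∑ i, v i • x i = c + t • (x j - c) := by
      simp only [v, add_smul, sum_add_distrib, mul_smul, ← smul_sum, ite_smul, one_smul, zero_smul,
        sum_ite_eq', mem_univ, if_true, ← hc]
      module
    have e2 : ∑ i, v i * ‖x i‖ ^ 2 = (1 - t) * S + t * ‖x j‖ ^ 2 := by
      simp only [v, add_mul, sum_add_distrib, mul_assoc, ← mul_sum, ite_mul, one_mul, zero_mul,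
        sum_ite_eq', mem_univ, if_true, ← hS]
    have e3 : φ v = (1 - t) * S + t * ‖x j‖ ^ 2 - ‖c + t • (x j - c)‖ ^ 2 := by
      rw [← e1, ← e2]
    have e4 : ‖x j‖ ^ 2 = ‖c‖ ^ 2 + 2 * inner ℝ c (x j - c) + a := by
      rw [ha, ← norm_add_sq_real]; congr 2; abel
    rw [e3, norm_add_sq_real, real_inner_smul_right, norm_smul, mul_pow, ← ha, e4, hφw,
      Real.norm_eq_abs, sq_abs] at hle
    rw [hφw]
    have : t * (a - (S - ‖c‖ ^ 2)) ≤ t * (t * a) := by linarith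
    exact le_of_mul_le_mul_left this ht0
  have ha0 : 0 ≤ a := by positivity
  by_contra! hlt
  have hb0 : 0 ≤ φ w := by
    have := key 1 one_pos le_rfl
    linarith
  have hapos : 0 < a := by linarith
  have := key ((a - φ w) / (2 * a)) (by apply div_pos <;> linarith)
    (by rw [div_le_one (by linarith)]; linarith)
  have h5 : (a - φ w) / (2 * a) * a = (a - φ w) / 2 := by field_simp
  linarith

/-- Jung's theorem in `ℝ^d`: any nonempty bounded set `K` is contained in a closed
ball of radius `√(d/(2(d+1))) · diam K`. -/
theorem jung_theorem (d : ℕ) (hd : 1 ≤ d)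
    (K : Set (EuclideanSpace ℝ (Fin d))) (hne : K.Nonempty)
    (hbdd : Bornology.IsBounded K) :
    ∃ c : EuclideanSpace ℝ (Fin d),
      K ⊆ Metric.closedBall c
        (Real.sqrt ((d : ℝ) / (2 * ((d : ℝ) + 1))) * Metric.diam K) := by
  set R := Real.sqrt ((d : ℝ) / (2 * ((d : ℝ) + 1))) * Metric.diam K with hR
  have hR0 : 0 ≤ R := mul_nonneg (Real.sqrt_nonneg _) Metric.diam_nonneg
  have hR2 : R ^ 2 = (d : ℝ) / (2 * ((d : ℝ) + 1)) * Metric.diam K ^ 2 := by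
    rw [hR, mul_pow, Real.sq_sqrt (by positivity)]
  have : (⋂ i : K, Metric.closedBall (i : EuclideanSpace ℝ (Fin d)) R).Nonempty := by
    refine Convex.helly_theorem_compact' (𝕜 := ℝ) (fun i => convex_closedBall _ _)
      (fun i => isCompact_closedBall _ _) ?_
    intro I hI
    rw [finrank_euclideanSpace_fin] at hI
    rcases I.eq_empty_or_nonempty with rfl | hIne
    · simp
    have : Nonempty I := hIne.to_subtype
    obtain ⟨c, hc⟩ := jung_finite (fun i : I => ((i : K) : EuclideanSpace ℝ (Fin d)))
      (Metric.diam K) Metric.diam_nonneg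
      (fun i j => Metric.dist_le_diam_of_mem hbdd i.1.2 j.1.2)
    refine ⟨c, ?_⟩
    simp only [Set.mem_iInter]
    intro i hi
    rw [Metric.mem_closedBall, dist_comm, dist_eq_norm]
    refine le_of_sq_le_sq ?_ hR0
    refine (hc ⟨i, hi⟩).trans ?_
    rw [hR2, Fintype.card_coe]
    refine mul_le_mul_of_nonneg_right ?_ (sq_nonneg _)
    have hpos : (0 : ℝ) < I.card := by exact_mod_cast hIne.card_pos
    have hle : (I.card : ℝ) ≤ d + 1 := by exact_mod_cast hI
    have h1 : 1 / ((d : ℝ) + 1) ≤ 1 / (I.card : ℝ) := one_div_le_one_div_of_le hpos hle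
    have h2 : (d : ℝ) / (2 * ((d : ℝ) + 1)) = (1 - 1 / ((d : ℝ) + 1)) / 2 := by
      field_simp; ring
    rw [h2]; linarith
  obtain ⟨c, hc⟩ := this
  refine ⟨c, fun y hy => ?_⟩
  have := Set.mem_iInter.1 hc ⟨y, hy⟩
  rw [Metric.mem_closedBall, dist_comm]
  exact this
end

section
/- Let k ≥ 1 and let σ be a nonempty finite subset of a real inner product space with at most k+1 elements. Then there exists a point c such that σ is contained in the closed ball of center c and radius (1/2)·√(2k/(k+1)) · diam(σ). In other words, a set spanning a simplex of dimension at most k admits an enclosing ball of radius at most (θ_k/2)·δ(σ), where θ_k = √(2k/(k+1)). -/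
theorem jung_simplex_aux {E : Type*} [NormedAddCommGroup E] [InnerProductSpace ℝ E]
    {ι : Type*} [Fintype ι] [Nonempty ι] (x : ι → E) (D : ℝ)
    (hD : ∀ i j, ‖x i - x j‖ ≤ D) :
    ∃ c : E, ∀ i, ‖x i - c‖ ^ 2 ≤ D ^ 2 / 2 * (1 - 1 / (Fintype.card ι : ℝ)) := by
  classical
  let F : (ι → ℝ) → ℝ := fun w => ∑ i, w i * ‖x i‖ ^ 2 - ‖∑ i, w i • x i‖ ^ 2
  have hF : Continuous F := by fun_prop
  obtain ⟨w, hw, hmax⟩ := (isCompact_stdSimplex ℝ ι).exists_isMaxOn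
    ⟨_, single_mem_stdSimplex ℝ (Classical.arbitrary ι)⟩ hF.continuousOn
  obtain ⟨hw0, hw1⟩ := id hw
  set c : E := ∑ i, w i • x i with hc
  set S : ℝ := ∑ i, w i * ‖x i‖ ^ 2 with hS
  have hFw : F w = S - ‖c‖ ^ 2 := rfl
  refine ⟨c, fun j => ?_⟩
  have hcx : ∀ y : E, ∑ i, w i * inner ℝ y (x i) = inner ℝ y c := by
    intro y
    simp [hc, inner_sum, inner_smul_right]
  -- optimality
  have h1 : ‖x j - c‖ ^ 2 ≤ S - ‖c‖ ^ 2 := by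
    by_contra! hlt
    have hA : ‖x j - c‖ ^ 2 = ‖x j‖ ^ 2 - 2 * inner ℝ (x j) c + ‖c‖ ^ 2 := norm_sub_sq_real _ _
    have key : ∀ t : ℝ, 0 ≤ t → t ≤ 1 →
        t * (‖x j - c‖ ^ 2 - (S - ‖c‖ ^ 2)) ≤ t ^ 2 * ‖x j - c‖ ^ 2 := by
      intro t ht0 ht1
      have hmem : (1 - t) • w + t • (Pi.single j 1 : ι → ℝ) ∈ stdSimplex ℝ ι :=
        (convex_stdSimplex ℝ ι) hw (single_mem_stdSimplex ℝ j) (by linarith) ht0 (by ring)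
      have hle : F _ ≤ F w := hmax hmem
      have e1 : ∑ i, ((1 - t) • w + t • (Pi.single j 1 : ι → ℝ)) i * ‖x i‖ ^ 2
          = (1 - t) * S + t * ‖x j‖ ^ 2 := by
        simp [add_mul, Finset.sum_add_distrib, hS, Finset.mul_sum, mul_assoc, Pi.single_apply]
      have e2 : ∑ i, ((1 - t) • w + t • (Pi.single j 1 : ι → ℝ)) i • x i
          = c + t • (x j - c) := by
        have : ∑ i, ((1 - t) • w + t • (Pi.single j 1 : ι → ℝ)) i • x i
          = (1 - t) • c + t • x j := by
          simp [add_smul, Finset.sum_add_distrib, hc, Finset.smul_sum, mul_smul, Pi.single_apply]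
        rw [this]; module
      have e3 : F ((1 - t) • w + t • (Pi.single j 1 : ι → ℝ)) =
          (1 - t) * S + t * ‖x j‖ ^ 2 - ‖c + t • (x j - c)‖ ^ 2 := by
        simp only [F]; rw [e1, e2]
      rw [e3, hFw, norm_add_sq_real, inner_smul_right, norm_smul, mul_pow, Real.norm_eq_abs,
        sq_abs, inner_sub_right, real_inner_self_eq_norm_sq, real_inner_comm] at hle
      have hA2 : t * ‖x j - c‖ ^ 2 = t * (‖x j‖ ^ 2 - 2 * inner ℝ (x j) c + ‖c‖ ^ 2) := by rw [hA]
      linarith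
    have hV : 0 ≤ S - ‖c‖ ^ 2 := by
      have : ∑ i, w i * ‖x i - c‖ ^ 2 = S - ‖c‖ ^ 2 := by
        have : ∀ i, w i * ‖x i - c‖ ^ 2 =
            w i * ‖x i‖ ^ 2 - 2 * (w i * inner ℝ c (x i)) + w i * ‖c‖ ^ 2 := by
          intro i; rw [norm_sub_sq_real, real_inner_comm]; ring
        simp only [this, Finset.sum_add_distrib, Finset.sum_sub_distrib, ← Finset.mul_sum,
          ← Finset.sum_mul, hcx, hw1, real_inner_self_eq_norm_sq]
        rw [← hS]; ring
      rw [← this]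
      exact Finset.sum_nonneg fun i _ => mul_nonneg (hw0 i) (sq_nonneg _)
    generalize ‖x j - c‖ ^ 2 = A at *
    generalize S - ‖c‖ ^ 2 = V at *
    have hApos : 0 < A := by linarith
    have := key ((A - V) / (2 * A)) (by apply div_nonneg <;> linarith)
      (by rw [div_le_one (by linarith)]; linarith)
    have e : ((A - V) / (2 * A)) * (A - V) - ((A - V) / (2 * A)) ^ 2 * A
      = (A - V) ^ 2 / (4 * A) := by field_simp; ring
    have : 0 < (A - V) ^ 2 / (4 * A) := by
      have : 0 < A - V := by linarith
      positivity
    linarith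
  refine h1.trans ?_
  have h2 : ∀ i, ‖x i‖ ^ 2 - 2 * inner ℝ (x i) c + S ≤ D ^ 2 * (1 - w i) := by
    intro i
    have e : ∑ l, w l * ‖x i - x l‖ ^ 2 = ‖x i‖ ^ 2 - 2 * inner ℝ (x i) c + S := by
      have : ∀ l, w l * ‖x i - x l‖ ^ 2 =
          w l * ‖x i‖ ^ 2 - 2 * (w l * inner ℝ (x i) (x l)) + w l * ‖x l‖ ^ 2 := by
        intro l; rw [norm_sub_sq_real]; ring
      simp only [this, Finset.sum_add_distrib, Finset.sum_sub_distrib, ← Finset.mul_sum,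
        ← Finset.sum_mul, hcx, hw1]
      rw [← hS]; ring
    rw [← e]
    calc ∑ l, w l * ‖x i - x l‖ ^ 2 ≤ ∑ l, (w l * D ^ 2 - if l = i then w i * D ^ 2 else 0) := by
          refine Finset.sum_le_sum fun l _ => ?_
          split_ifs with h
          · subst h; simp
          · rw [sub_zero]
            exact mul_le_mul_of_nonneg_left
              (pow_le_pow_left₀ (norm_nonneg _) (hD i l) 2) (hw0 l)
      _ = D ^ 2 * (1 - w i) := by
          rw [Finset.sum_sub_distrib, ← Finset.sum_mul, hw1]; simp; ring
  have h3 : 2 * (S - ‖c‖ ^ 2) ≤ D ^ 2 * (1 - ∑ i, w i ^ 2) := by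
    have := Finset.sum_le_sum fun i (_ : i ∈ Finset.univ) =>
      mul_le_mul_of_nonneg_left (h2 i) (hw0 i)
    have el : ∑ i, w i * (‖x i‖ ^ 2 - 2 * inner ℝ (x i) c + S) = 2 * (S - ‖c‖ ^ 2) := by
      have : ∀ i, w i * (‖x i‖ ^ 2 - 2 * inner ℝ (x i) c + S) =
          w i * ‖x i‖ ^ 2 - 2 * (w i * inner ℝ c (x i)) + w i * S := by
        intro i; rw [real_inner_comm]; ring
      simp only [this, Finset.sum_add_distrib, Finset.sum_sub_distrib, ← Finset.mul_sum,
        ← Finset.sum_mul, hcx, hw1, real_inner_self_eq_norm_sq]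
      rw [← hS]; ring
    have er : ∑ i, w i * (D ^ 2 * (1 - w i)) = D ^ 2 * (1 - ∑ i, w i ^ 2) := by
      have : ∀ i, w i * (D ^ 2 * (1 - w i)) = D ^ 2 * (w i - w i ^ 2) := by intro i; ring
      simp only [this, ← Finset.mul_sum, Finset.sum_sub_distrib, hw1]
    rwa [el, er] at this
  have h4 : 1 / (Fintype.card ι : ℝ) ≤ ∑ i, w i ^ 2 := by
    have := sq_sum_le_card_mul_sum_sq (s := Finset.univ) (f := w)
    rw [hw1, Finset.card_univ] at this
    rw [div_le_iff₀ (by exact_mod_cast Fintype.card_pos)]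
    linarith
  nlinarith [mul_le_mul_of_nonneg_left h4 (sq_nonneg D)]

/-- Jung's bound for simplices: a nonempty finite set `σ` with at most `k+1` points in a
real inner product space is enclosed in a ball of radius `(1/2)·√(2k/(k+1)) · diam σ`. -/
theorem jung_simplex {E : Type*} [NormedAddCommGroup E] [InnerProductSpace ℝ E]
    (k : ℕ) (hk : 1 ≤ k) (σ : Finset E) (hne : σ.Nonempty) (hcard : σ.card ≤ k + 1) :
    ∃ c : E, (σ : Set E) ⊆ Metric.closedBall c
      ((1 / 2) * Real.sqrt (2 * (k : ℝ) / ((k : ℝ) + 1)) * Metric.diam (σ : Set E)) := by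
  haveI : Nonempty σ := hne.to_subtype
  obtain ⟨c, hc⟩ := jung_simplex_aux (fun i : σ => (i : E)) (Metric.diam (σ : Set E))
    (fun i j => by
      rw [← dist_eq_norm]
      exact Metric.dist_le_diam_of_mem σ.finite_toSet.isBounded i.2 j.2)
  refine ⟨c, fun y hy => ?_⟩
  rw [Metric.mem_closedBall, dist_eq_norm]
  have h := hc ⟨y, hy⟩
  have hD : 0 ≤ Metric.diam (σ : Set E) := Metric.diam_nonneg
  simp only [Fintype.card_coe] at h
  apply le_of_sq_le_sq _ (by positivity)
  rw [mul_pow, mul_pow, Real.sq_sqrt (by positivity)]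
  refine h.trans ?_
  have hpos : (0 : ℝ) < σ.card := by exact_mod_cast hne.card_pos
  have h5 : 1 / ((k : ℝ) + 1) ≤ 1 / (σ.card : ℝ) :=
    one_div_le_one_div_of_le hpos (by exact_mod_cast hcard)
  have e : (1 / 2 : ℝ) ^ 2 * (2 * (k : ℝ) / ((k : ℝ) + 1)) * Metric.diam (σ : Set E) ^ 2
      = Metric.diam (σ : Set E) ^ 2 / 2 * (1 - 1 / ((k : ℝ) + 1)) := by
    field_simp; ring
  rw [e]
  exact mul_le_mul_of_nonneg_left (by linarith) (by positivity)
end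

section
/- Let d ≥ 1, k ≥ 1, and let σ ⊆ ℝ^d be a finite set with exactly k+1 elements. Define the minimum enclosing ball radius meb(σ) := ⨅_{c ∈ ℝ^d} sup_{x ∈ σ} dist(c, x). Then diam(σ) ≤ 2·meb(σ) and 2·meb(σ) ≤ √(2k/(k+1)) · diam(σ). -/
section JungAux
variable {E : Type*} [NormedAddCommGroup E] [InnerProductSpace ℝ E]

lemma jung_iSup_le (σ : Finset E) (c : E) (R : ℝ) (hR : 0 ≤ R) (h : ∀ x ∈ σ, dist c x ≤ R) :
    (⨆ x ∈ σ, dist c x) ≤ R :=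
  Real.iSup_le (fun x => Real.iSup_le (fun hx => h x hx) hR) hR

lemma jung_le_iSup (σ : Finset E) (c : E) (x : E) (hx : x ∈ σ) :
    dist c x ≤ ⨆ x ∈ σ, dist c x := by
  have hb : BddAbove (Set.range fun x => ⨆ _ : x ∈ σ, dist c x) := by
    refine ⟨∑ y ∈ σ, dist c y, ?_⟩
    rintro _ ⟨y, rfl⟩
    have h0 : 0 ≤ ∑ y ∈ σ, dist c y := Finset.sum_nonneg fun _ _ => dist_nonneg
    exact Real.iSup_le
      (fun hy => Finset.single_le_sum (f := fun y => dist c y) (fun _ _ => dist_nonneg) hy) h0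
  have := le_ciSup hb x
  simpa [hx] using this

/-- weighted variance -/
noncomputable def jungVar {ι : Type*} [Fintype ι] (x : ι → E) (w : ι → ℝ) : ℝ :=
  ∑ i, w i * ‖x i‖ ^ 2 - ‖∑ i, w i • x i‖ ^ 2

lemma jungVar_double {ι : Type*} [Fintype ι] (x : ι → E) (w : ι → ℝ) (hw : ∑ i, w i = 1) :
    ∑ i, ∑ j, w i * w j * ‖x i - x j‖ ^ 2 = 2 * jungVar x w := by
  have h1 : ‖∑ i, w i • x i‖ ^ 2 = ∑ i, ∑ j, w i * w j * inner ℝ (x i) (x j) := by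
    rw [← real_inner_self_eq_norm_sq, sum_inner]
    refine Finset.sum_congr rfl fun i _ => ?_
    rw [inner_sum]
    refine Finset.sum_congr rfl fun j _ => ?_
    rw [real_inner_smul_left, real_inner_smul_right]; ring
  have h2 : ∑ i, w i * ‖x i‖ ^ 2 = ∑ i, ∑ j, w i * w j * ‖x i‖ ^ 2 := by
    refine Finset.sum_congr rfl fun i _ => ?_
    rw [← Finset.sum_mul, ← Finset.mul_sum, hw, mul_one]
  have h3 : ∑ i, w i * ‖x i‖ ^ 2 = ∑ i, ∑ j, w i * w j * ‖x j‖ ^ 2 := by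
    rw [h2, Finset.sum_comm]
    refine Finset.sum_congr rfl fun i _ => Finset.sum_congr rfl fun j _ => ?_
    ring
  have : 2 * jungVar x w = ∑ i, w i * ‖x i‖ ^ 2 + ∑ i, w i * ‖x i‖ ^ 2
      - 2 * ‖∑ i, w i • x i‖ ^ 2 := by unfold jungVar; ring
  rw [this, h1]
  nth_rewrite 1 [h2]
  rw [h3, Finset.mul_sum, ← Finset.sum_add_distrib, ← Finset.sum_sub_distrib]
  refine Finset.sum_congr rfl fun i _ => ?_
  rw [Finset.mul_sum, ← Finset.sum_add_distrib, ← Finset.sum_sub_distrib]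
  refine Finset.sum_congr rfl fun j _ => ?_
  rw [norm_sub_sq_real]; ring

lemma jungVar_le {ι : Type*} [Fintype ι] [Nonempty ι] (x : ι → E) (w : ι → ℝ)
    (hw0 : ∀ i, 0 ≤ w i) (hw : ∑ i, w i = 1) (D : ℝ) (hD : ∀ i j, ‖x i - x j‖ ≤ D) :
    2 * jungVar x w ≤ D ^ 2 * (1 - 1 / (Fintype.card ι : ℝ)) := by
  classical
  rw [← jungVar_double x w hw]
  have hle : ∑ i, ∑ j, w i * w j * ‖x i - x j‖ ^ 2
      ≤ ∑ i, ∑ j, (D ^ 2 * (w i * w j) - if i = j then D ^ 2 * w i ^ 2 else 0) := by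
    refine Finset.sum_le_sum fun i _ => Finset.sum_le_sum fun j _ => ?_
    split_ifs with h
    · subst h; simp; apply le_of_eq; ring
    · have := pow_le_pow_left₀ (norm_nonneg _) (hD i j) 2
      nlinarith [mul_nonneg (hw0 i) (hw0 j)]
  refine hle.trans ?_
  have : ∑ i, ∑ j, (D ^ 2 * (w i * w j) - if i = j then D ^ 2 * w i ^ 2 else 0)
      = D ^ 2 * (1 - ∑ i, w i ^ 2) := by
    simp only [Finset.sum_sub_distrib, ← Finset.mul_sum, Finset.sum_ite_eq, Finset.mem_univ,
      if_true, hw, mul_one]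
    ring
  rw [this]
  have hcs := sq_sum_le_card_mul_sum_sq (s := Finset.univ) (f := w)
  rw [hw, Finset.card_univ] at hcs
  have hc : (0 : ℝ) < Fintype.card ι := by exact_mod_cast Fintype.card_pos
  have : 1 / (Fintype.card ι : ℝ) ≤ ∑ i, w i ^ 2 := by
    rw [div_le_iff₀ hc]; linarith
  gcongr

lemma jungVar_max {ι : Type*} [Fintype ι] (x : ι → E) (w : ι → ℝ)
    (hw : w ∈ stdSimplex ℝ ι) (hmax : ∀ v ∈ stdSimplex ℝ ι, jungVar x v ≤ jungVar x w) (i : ι) :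
    ‖(∑ i, w i • x i) - x i‖ ^ 2 ≤ jungVar x w := by
  classical
  set c := ∑ i, w i • x i with hc
  have key : ∀ t : ℝ, 0 < t → t < 1 → (1 - t) * ‖c - x i‖ ^ 2 ≤ jungVar x w := by
    intro t ht0 ht1
    have hv := hmax _ (convex_stdSimplex ℝ ι hw (single_mem_stdSimplex ℝ i)
      (by linarith : 0 ≤ 1 - t) ht0.le (by ring))
    have e1 : ∑ j, ((1 - t) • w + t • Pi.single i (1 : ℝ) : ι → ℝ) j • x j = (1 - t) • c + t • x i := by
      simp [add_smul, Finset.sum_add_distrib, mul_smul, hc, Finset.smul_sum, Pi.single_apply]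
    have e2 : ∑ j, ((1 - t) • w + t • Pi.single i (1 : ℝ) : ι → ℝ) j * ‖x j‖ ^ 2
        = (1 - t) * ∑ j, w j * ‖x j‖ ^ 2 + t * ‖x i‖ ^ 2 := by
      simp [add_mul, Finset.sum_add_distrib, mul_assoc, Finset.mul_sum, Pi.single_apply]
    have e3 : ‖(1 - t) • c + t • x i‖ ^ 2
        = (1 - t) ^ 2 * ‖c‖ ^ 2 + 2 * ((1 - t) * t * inner ℝ c (x i)) + t ^ 2 * ‖x i‖ ^ 2 := by
      rw [norm_add_sq_real, norm_smul, norm_smul, real_inner_smul_left, real_inner_smul_right,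
        mul_pow, mul_pow, Real.norm_eq_abs, Real.norm_eq_abs, sq_abs, sq_abs]
      ring
    unfold jungVar at hv ⊢
    rw [e1, e2, e3, ← hc] at hv
    rw [norm_sub_sq_real, ← hc]
    refine le_of_mul_le_mul_left ?_ ht0
    linarith
  have hlim : Filter.Tendsto (fun t : ℝ => (1 - t) * ‖c - x i‖ ^ 2) (nhdsWithin 0 (Set.Ioi 0))
      (nhds ((1 - 0) * ‖c - x i‖ ^ 2)) := by
    apply Filter.Tendsto.mono_left _ nhdsWithin_le_nhds
    exact Continuous.tendsto (by fun_prop) 0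
  rw [sub_zero, one_mul] at hlim
  refine le_of_tendsto hlim ?_
  filter_upwards [Ioo_mem_nhdsGT (show (0 : ℝ) < 1 by norm_num)] with t ht
  exact key t ht.1 ht.2

lemma jung_center {ι : Type*} [Fintype ι] [Nonempty ι] (x : ι → E) (D : ℝ)
    (hD : ∀ i j, ‖x i - x j‖ ≤ D) :
    ∃ c : E, ∀ i, 2 * ‖c - x i‖ ^ 2 ≤ D ^ 2 * (1 - 1 / (Fintype.card ι : ℝ)) := by
  classical
  have hne : (stdSimplex ℝ ι).Nonempty :=
    ⟨_, single_mem_stdSimplex ℝ (Classical.arbitrary ι)⟩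
  have hcont : Continuous (jungVar x) := by unfold jungVar; fun_prop
  obtain ⟨w, hw, hmax⟩ := (isCompact_stdSimplex ℝ ι).exists_isMaxOn hne hcont.continuousOn
  refine ⟨∑ i, w i • x i, fun i => ?_⟩
  have h1 := jungVar_max x w hw (fun v hv => hmax hv) i
  have h2 := jungVar_le x w hw.1 hw.2 D hD
  linarith

end JungAux


/-- For a set `σ` of exactly `k+1` points in `ℝ^d`, with
`meb σ = ⨅ c, ⨆ x ∈ σ, dist c x` the minimum enclosing ball radius, we have
`diam σ ≤ 2 · meb σ ≤ √(2k/(k+1)) · diam σ`. -/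
theorem diam_le_two_meb_le_jung_mul_diam (d k : ℕ) (hd : 1 ≤ d) (hk : 1 ≤ k)
    (σ : Finset (EuclideanSpace ℝ (Fin d))) (hcard : σ.card = k + 1) :
    Metric.diam (σ : Set (EuclideanSpace ℝ (Fin d))) ≤
        2 * (⨅ c : EuclideanSpace ℝ (Fin d), ⨆ x ∈ σ, dist c x) ∧
      2 * (⨅ c : EuclideanSpace ℝ (Fin d), ⨆ x ∈ σ, dist c x) ≤
        Real.sqrt (2 * (k : ℝ) / ((k : ℝ) + 1)) *
          Metric.diam (σ : Set (EuclideanSpace ℝ (Fin d))) := by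

  constructor
  · apply Metric.diam_le_of_forall_dist_le
    · exact mul_nonneg (by norm_num) (Real.iInf_nonneg fun c => Real.iSup_nonneg fun x =>
        Real.iSup_nonneg fun _ => dist_nonneg)
    · intro x hx y hy
      have : dist x y / 2 ≤ ⨅ c : EuclideanSpace ℝ (Fin d), ⨆ x ∈ σ, dist c x := by
        refine le_ciInf fun c => ?_
        have h1 := jung_le_iSup σ c x hx
        have h2 := jung_le_iSup σ c y hy
        have h3 := dist_triangle_left x y c
        linarith
      linarith
  · set D := Metric.diam (σ : Set (EuclideanSpace ℝ (Fin d))) with hDdef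
    have hD0 : 0 ≤ D := Metric.diam_nonneg
    have hne : σ.Nonempty := Finset.card_pos.mp (by omega)
    haveI : Nonempty σ := hne.to_subtype
    obtain ⟨c, hc⟩ := jung_center (fun i : σ => (i : EuclideanSpace ℝ (Fin d))) D
      (fun i j => by
        rw [← dist_eq_norm]
        exact Metric.dist_le_diam_of_mem σ.finite_toSet.isBounded i.2 j.2)
    rw [Fintype.card_coe, hcard] at hc
    have hR : (⨆ x ∈ σ, dist c x) ≤ Real.sqrt (2 * (k : ℝ) / ((k : ℝ) + 1)) * D / 2 := by
      refine jung_iSup_le σ c _ (by positivity) fun x hx => ?_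
      refine abs_le_of_sq_le_sq' ?_ (by positivity) |>.2
      have h := hc ⟨x, hx⟩
      rw [div_pow, mul_pow, Real.sq_sqrt (by positivity), dist_eq_norm]
      have hk1 : (1 : ℝ) - 1 / ((k + 1 : ℕ) : ℝ) = k / (k + 1) := by
        push_cast; field_simp; ring
      rw [hk1] at h
      have : 2 * (k : ℝ) / (k + 1) = 2 * (k / (k + 1)) := by ring
      rw [this]
      simp only at h
      linarith
    have hinf : (⨅ c : EuclideanSpace ℝ (Fin d), ⨆ x ∈ σ, dist c x) ≤ ⨆ x ∈ σ, dist c x := by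
      refine ciInf_le ⟨0, ?_⟩ c
      rintro _ ⟨c, rfl⟩
      exact Real.iSup_nonneg fun x => Real.iSup_nonneg fun _ => dist_nonneg
    linarith
end

section
/- Let m ≥ 1, d ≥ 1, let s > 0, and let p_0, …, p_m be m+1 points in ℝ^d such that dist(p_i, p_j) = s for all i ≠ j. Let σ := {p_0, …, p_m} and meb(σ) := ⨅_{c ∈ ℝ^d} sup_{x ∈ σ} dist(c, x). Then meb(σ) = s · √(m/(2(m+1))); that is, Jung's inequality 2·meb(σ) ≤ √(2m/(m+1)) · diam(σ) holds with equality for the vertex set of a regular m-simplex, and the infimum defining meb(σ) is realized by the centroid of the points. -/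
lemma simplex_row (m d : ℕ) (s : ℝ)
    (q : Fin (m + 1) → EuclideanSpace ℝ (Fin d))
    (hq : ∀ i j, i ≠ j → ‖q i - q j‖ = s) (i : Fin (m + 1)) :
    ((m : ℝ) + 1) * ‖q i‖ ^ 2 - 2 * inner ℝ (q i) (∑ j, q j) + ∑ j, ‖q j‖ ^ 2 = m * s ^ 2 := by
  have h1 : ∑ j, ‖q i - q j‖ ^ 2 = m * s ^ 2 := by
    rw [← Finset.add_sum_erase _ _ (Finset.mem_univ i),
      Finset.sum_congr rfl (g := fun _ => s ^ 2)]
    · simp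
    · intro j hj
      rw [hq i j (Finset.ne_of_mem_erase hj).symm]
  rw [← h1]
  simp only [norm_sub_sq_real, Finset.sum_add_distrib, Finset.sum_sub_distrib, inner_sum,
    Finset.mul_sum]
  simp

lemma simplex_total (m d : ℕ) (s : ℝ)
    (q : Fin (m + 1) → EuclideanSpace ℝ (Fin d))
    (hq : ∀ i j, i ≠ j → ‖q i - q j‖ = s) :
    2 * ((m : ℝ) + 1) * ∑ j, ‖q j‖ ^ 2 - 2 * ‖∑ j, q j‖ ^ 2 = (m + 1) * (m * s ^ 2) := by
  have h := Finset.sum_congr (rfl : (Finset.univ : Finset (Fin (m + 1))) = Finset.univ)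
    (fun i _ => simplex_row m d s q hq i)
  simp only [Finset.sum_add_distrib, Finset.sum_sub_distrib, ← Finset.mul_sum, ← sum_inner,
    real_inner_self_eq_norm_sq] at h
  simp only [Finset.sum_const, Finset.card_univ, Fintype.card_fin, nsmul_eq_mul] at h
  push_cast at h
  linarith

/-- Jung's inequality is attained with equality by regular simplices: if `p 0, …, p m` are
`m+1` points of `ℝ^d` pairwise at distance `s`, then the minimum enclosing ball radius
`meb σ = ⨅ c, ⨆ x ∈ σ, dist c x` of `σ = {p 0, …, p m}` equals `s·√(m/(2(m+1)))`. -/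
theorem regular_simplex_meb (m d : ℕ) (hm : 1 ≤ m) (hd : 1 ≤ d) (s : ℝ) (hs : 0 < s)
    (p : Fin (m + 1) → EuclideanSpace ℝ (Fin d))
    (hp : ∀ i j, i ≠ j → dist (p i) (p j) = s) :
    (⨅ c : EuclideanSpace ℝ (Fin d), ⨆ x ∈ Set.range p, dist c x) =
      s * Real.sqrt ((m : ℝ) / (2 * ((m : ℝ) + 1))) := by
  have hn : (0 : ℝ) < (m : ℝ) + 1 := by positivity
  set R := s * Real.sqrt ((m : ℝ) / (2 * ((m : ℝ) + 1))) with hR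
  have hR0 : 0 ≤ R := by positivity
  have hR2 : 2 * ((m : ℝ) + 1) * R ^ 2 = m * s ^ 2 := by
    rw [hR, mul_pow, Real.sq_sqrt (by positivity)]
    field_simp
  have hq : ∀ c : EuclideanSpace ℝ (Fin d), ∀ i j, i ≠ j → ‖(p i - c) - (p j - c)‖ = s := by
    intro c i j hij
    rw [sub_sub_sub_cancel_right, ← dist_eq_norm, hp i j hij]
  have hB0 : ∀ c : EuclideanSpace ℝ (Fin d), 0 ≤ ⨆ x ∈ Set.range p, dist c x := fun c =>
    Real.iSup_nonneg fun x => Real.iSup_nonneg fun _ => dist_nonneg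
  apply le_antisymm
  · set g : EuclideanSpace ℝ (Fin d) := ((m : ℝ) + 1)⁻¹ • ∑ i, p i with hg
    refine (ciInf_le ⟨0, ?_⟩ g).trans ?_
    · rintro _ ⟨c, rfl⟩
      exact hB0 c
    · refine Real.iSup_le (fun x => Real.iSup_le ?_ hR0) hR0
      rintro ⟨i, rfl⟩
      have hS : ∑ j, (p j - g) = 0 := by
        rw [Finset.sum_sub_distrib, Finset.sum_const, Finset.card_univ, Fintype.card_fin,
          ← Nat.cast_smul_eq_nsmul ℝ, hg, smul_smul]
        push_cast
        rw [mul_inv_cancel₀ hn.ne', one_smul, sub_self]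
      have h1 := simplex_row m d s (fun j => p j - g) (hq g) i
      have h2 := simplex_total m d s (fun j => p j - g) (hq g)
      simp only [hS, inner_zero_right, norm_zero] at h1 h2
      have h3 : 2 * ∑ j, ‖p j - g‖ ^ 2 = m * s ^ 2 := by
        apply mul_left_cancel₀ hn.ne'
        linarith
      rw [dist_comm, dist_eq_norm]
      refine (abs_le_of_sq_le_sq' ?_ hR0).2
      apply le_of_mul_le_mul_left _ hn
      linarith
  · refine le_ciInf fun c => ?_
    set B := ⨆ x ∈ Set.range p, dist c x with hB
    have hle : ∀ i, ‖p i - c‖ ≤ B := by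
      intro i
      rw [← dist_eq_norm, dist_comm]
      have hb : BddAbove (Set.range fun x => ⨆ (_ : x ∈ Set.range p), dist c x) := by
        refine ⟨∑ j, dist c (p j), ?_⟩
        rintro _ ⟨x, rfl⟩
        have h0 : 0 ≤ ∑ j, dist c (p j) := Finset.sum_nonneg fun _ _ => dist_nonneg
        refine Real.iSup_le ?_ h0
        rintro ⟨j, rfl⟩
        exact Finset.single_le_sum (f := fun j => dist c (p j))
          (fun _ _ => dist_nonneg) (Finset.mem_univ j)
      refine le_trans ?_ (le_ciSup hb (p i))
      exact (ciSup_pos (f := fun _ => dist c (p i)) (Set.mem_range_self i)).ge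
    have h2 := simplex_total m d s (fun j => p j - c) (hq c)
    have h3 : ∑ j, ‖p j - c‖ ^ 2 ≤ ((m : ℝ) + 1) * B ^ 2 := by
      calc ∑ j, ‖p j - c‖ ^ 2 ≤ ∑ _j : Fin (m + 1), B ^ 2 :=
            Finset.sum_le_sum fun j _ => pow_le_pow_left₀ (norm_nonneg _) (hle j) 2
        _ = _ := by simp
    have h4 : m * s ^ 2 ≤ 2 * ∑ j, ‖p j - c‖ ^ 2 := by
      apply le_of_mul_le_mul_left _ hn
      have := sq_nonneg ‖∑ j, (p j - c)‖
      linarith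
    refine (abs_le_of_sq_le_sq' ?_ (hB0 c)).2
    apply le_of_mul_le_mul_left _ hn
    linarith
end

section
/- Let X be a finite set of points in a metric space, and let T be a minimum spanning tree of X, i.e., a tree on vertex set X minimizing the total edge length ∑_{{u,v} edge of T} dist(u,v) among all trees on vertex set X. Then every edge {x, y} of T satisfies the relative neighborhood condition: there is no point z ∈ X with dist(x, z) < dist(x, y) and dist(y, z) < dist(x, y). In other words, every minimum spanning tree edge is an edge of the relative neighborhood graph RNG(X). -/
attribute [local instance] Classical.propDecidable

/-- The total edge length of a graph `T` on the vertex set `X ⊆ α`. -/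
noncomputable def edgeLength {α : Type*} [MetricSpace α] (X : Finset α)
    (T : SimpleGraph ↥X) : ℝ :=
  ∑ e ∈ T.edgeFinset,
    Sym2.lift ⟨fun u v : ↥X => dist (u : α) (v : α), fun _ _ => dist_comm _ _⟩ e

theorem mst_aux {α : Type*} [MetricSpace α] (X : Finset α)
    (T : SimpleGraph ↥X) (hT : T.IsTree)
    (hmin : ∀ T' : SimpleGraph ↥X, T'.IsTree → edgeLength X T ≤ edgeLength X T')
    (x y z : ↥X) (hxy : T.Adj x y)
    (hyz : (T.deleteEdges {s(x, y)}).Reachable y z)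
    (hd : dist (x : α) z < dist (x : α) (y : α)) : False := by
  have hb : ¬ (T.deleteEdges {s(x, y)}).Reachable x y := by
    have := SimpleGraph.isAcyclic_iff_forall_isBridge.mp hT.isAcyclic
      (e := s(x, y)) hxy
    exact SimpleGraph.isBridge_iff.mp this
  have hxz : ¬ (T.deleteEdges {s(x, y)}).Reachable x z := fun h => hb (h.trans hyz.symm)
  have hne : x ≠ z := by
    rintro rfl
    exact hxz (SimpleGraph.Reachable.refl _)
  set D := T.deleteEdges {s(x, y)} with hD
  have hac : (D ⊔ SimpleGraph.edge x z).IsAcyclic :=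
    (hT.isAcyclic.anti (SimpleGraph.deleteEdges_le _)).sup_edge_of_not_reachable hxz
  have hDle : D ≤ D ⊔ SimpleGraph.edge x z := le_sup_left
  have hrxz : (D ⊔ SimpleGraph.edge x z).Reachable x z := by
    apply SimpleGraph.Adj.reachable
    simp [SimpleGraph.edge_adj, hne]
  have hrxy : (D ⊔ SimpleGraph.edge x z).Reachable x y := hrxz.trans (hyz.mono hDle).symm
  have hadj : ∀ a b, T.Adj a b → (D ⊔ SimpleGraph.edge x z).Reachable a b := by
    intro a b hab
    by_cases he : s(a, b) = s(x, y)
    · rcases Sym2.eq_iff.mp he with ⟨rfl, rfl⟩ | ⟨rfl, rfl⟩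
      · exact hrxy
      · exact hrxy.symm
    · apply SimpleGraph.Adj.reachable
      apply hDle
      rw [hD, SimpleGraph.deleteEdges_adj]
      exact ⟨hab, he⟩
  have hwalk : ∀ a b, T.Walk a b → (D ⊔ SimpleGraph.edge x z).Reachable a b := by
    intro a b w
    induction w with
    | nil => exact SimpleGraph.Reachable.refl _
    | cons h _ ih => exact (hadj _ _ h).trans ih
  have htree : (D ⊔ SimpleGraph.edge x z).IsTree := by
    have : Nonempty ↥X := ⟨x⟩
    refine ⟨⟨fun a b => ?_⟩, hac⟩
    obtain ⟨w⟩ := hT.connected.preconnected a b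
    exact hwalk a b w
  have hm := hmin _ htree
  unfold edgeLength at hm
  set f : Sym2 ↥X → ℝ := Sym2.lift ⟨fun u v : ↥X => dist (u : α) (v : α),
    fun _ _ => dist_comm _ _⟩ with hf
  have hfn : ∀ e, 0 ≤ f e := by
    intro e
    induction e with
    | h a b => simp [hf]
  have hsub : (D ⊔ SimpleGraph.edge x z).edgeFinset ⊆
      insert s(x, z) (T.edgeFinset.erase s(x, y)) := by
    intro e
    induction e with
    | h a b =>
      simp only [SimpleGraph.mem_edgeFinset, SimpleGraph.mem_edgeSet, SimpleGraph.sup_adj, hD,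
        SimpleGraph.deleteEdges_adj, SimpleGraph.edge_adj, Finset.mem_insert, Finset.mem_erase,
        Set.mem_singleton_iff, ne_eq, Sym2.eq_iff]
      tauto
  have h1 := Finset.sum_le_sum_of_subset_of_nonneg hsub (f := f) (fun e _ _ => hfn e)
  have h2 : ∑ e ∈ insert s(x, z) (T.edgeFinset.erase s(x, y)), f e
      ≤ f s(x, z) + ∑ e ∈ T.edgeFinset.erase s(x, y), f e := by
    by_cases hmem : s(x, z) ∈ T.edgeFinset.erase s(x, y)
    · rw [Finset.insert_eq_of_mem hmem]
      linarith [hfn s(x, z)]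
    · rw [Finset.sum_insert hmem]
  have h3 : ∑ e ∈ T.edgeFinset.erase s(x, y), f e + f s(x, y) = ∑ e ∈ T.edgeFinset, f e :=
    Finset.sum_erase_add _ _ (by simpa using hxy)
  have hm2 : ∑ e ∈ T.edgeFinset, f e ≤ ∑ e ∈ (D ⊔ SimpleGraph.edge x z).edgeFinset, f e := by
    convert hm
  have h4 : f s(x, z) < f s(x, y) := hd
  linarith

/-- Every edge of a minimum spanning tree of a finite point set `X` in a metric space
satisfies the relative neighborhood condition: `MST(X) ⊆ RNG(X)`. -/
theorem mst_subset_rng {α : Type*} [MetricSpace α] (X : Finset α)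
    (T : SimpleGraph ↥X) (hT : T.IsTree)
    (hmin : ∀ T' : SimpleGraph ↥X, T'.IsTree → edgeLength X T ≤ edgeLength X T')
    (x y : ↥X) (hxy : T.Adj x y) :
    ¬ ∃ z ∈ X, dist (x : α) z < dist (x : α) (y : α) ∧
        dist (y : α) z < dist (x : α) (y : α) := by
  rintro ⟨z, hz, h1, h2⟩
  have key : ∀ a b, T.Walk a b →
      ((T.deleteEdges {s(x, y)}).Reachable x a ∨ (T.deleteEdges {s(x, y)}).Reachable y a) →
      ((T.deleteEdges {s(x, y)}).Reachable x b ∨ (T.deleteEdges {s(x, y)}).Reachable y b) := by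
    intro a b w
    induction w with
    | nil => exact id
    | @cons u v _ h _ ih =>
      intro hu
      apply ih
      by_cases he : s(u, v) = s(x, y)
      · rcases Sym2.eq_iff.mp he with ⟨rfl, rfl⟩ | ⟨rfl, rfl⟩
        · exact Or.inr (SimpleGraph.Reachable.refl _)
        · exact Or.inl (SimpleGraph.Reachable.refl _)
      · have : (T.deleteEdges {s(x, y)}).Adj u v := by
          rw [SimpleGraph.deleteEdges_adj]
          exact ⟨h, he⟩
        exact hu.imp (fun k => k.trans this.reachable) (fun k => k.trans this.reachable)
  obtain ⟨w⟩ := hT.connected.preconnected x ⟨z, hz⟩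
  rcases key _ _ w (Or.inl (SimpleGraph.Reachable.refl _)) with h | h
  · refine mst_aux X T hT hmin y x ⟨z, hz⟩ hxy.symm ?_ ?_
    · rwa [Sym2.eq_swap]
    · rwa [dist_comm (y : α) (x : α)]
  · exact mst_aux X T hT hmin x y ⟨z, hz⟩ hxy h h1
end

section
/- Let X be a finite set of points in ℝ^d and let {x, y} ⊆ X, x ≠ y, be an edge of the relative neighborhood graph of X, i.e., there is no z ∈ X with dist(x, z) < dist(x, y) and dist(y, z) < dist(x, y). Then there exist a center c ∈ ℝ^d and a radius r ≥ 0 such that dist(c, x) = dist(c, y) = r and dist(c, z) ≥ r for every z ∈ X with z ≠ x and z ≠ y; indeed one may take c the midpoint of x and y and r = dist(x,y)/2. In particular, every relative neighborhood graph edge is a Delaunay edge of X, i.e., RNG(X) ⊆ DEL(X) at the level of edges. -/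
/-- Every edge of the relative neighborhood graph of a finite point set `X ⊆ ℝ^d` is a
Delaunay edge: there is an empty circumball through `x` and `y` (indeed the ball with
the segment `[x, y]` as diameter works), i.e. `RNG(X) ⊆ DEL(X)`. -/
theorem rng_subset_delaunay {d : ℕ} (X : Finset (EuclideanSpace ℝ (Fin d)))
    (x y : EuclideanSpace ℝ (Fin d)) (hx : x ∈ X) (hy : y ∈ X) (hxy : x ≠ y)
    (hrng : ¬ ∃ z ∈ X, dist x z < dist x y ∧ dist y z < dist x y) :
    ∃ (c : EuclideanSpace ℝ (Fin d)) (r : ℝ), 0 ≤ r ∧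
      dist c x = r ∧ dist c y = r ∧
      ∀ z ∈ X, z ≠ x → z ≠ y → r ≤ dist c z := by
  have h1 : dist (midpoint ℝ x y) x = dist x y / 2 := by
    rw [dist_midpoint_left, Real.norm_ofNat]; ring
  have h2 : dist (midpoint ℝ x y) y = dist x y / 2 := by
    rw [dist_midpoint_right, Real.norm_ofNat]; ring
  refine ⟨midpoint ℝ x y, dist x y / 2, by positivity, h1, h2, ?_⟩
  intro z hz _ _
  by_contra hlt
  have hlt' := not_le.mp hlt
  refine hrng ⟨z, hz, ?_, ?_⟩
  · have := dist_triangle_left x z (midpoint ℝ x y)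
    linarith
  · have := dist_triangle_left y z (midpoint ℝ x y)
    linarith
end

section
/- Let d ≥ 1 and let K be a nonempty bounded subset of ℝ^d. Then there exists a point c ∈ ℝ^d such that K is contained in the closed ball of center c and radius diam(K)/√2. Equivalently, 2·meb(K) ≤ √2 · diam(K), a bound uniform in the ambient dimension d; this is the dimension-free constant giving the inclusions Čech_r(X) ⊆ Rips_r(X) ⊆ Čech_{√2·r}(X). -/
/-- Dimension-free Jung bound: any nonempty bounded set `K ⊆ ℝ^d` is contained in a
closed ball of radius `diam K / √2`, i.e. `2·meb(K) ≤ √2 · diam(K)`. -/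
theorem jung_dimension_free (d : ℕ) (hd : 1 ≤ d)
    (K : Set (EuclideanSpace ℝ (Fin d))) (hne : K.Nonempty)
    (hbdd : Bornology.IsBounded K) :
    ∃ c : EuclideanSpace ℝ (Fin d),
      K ⊆ Metric.closedBall c (Metric.diam K / Real.sqrt 2) := by
  have hC : IsCompact (closure K) := hbdd.isCompact_closure
  have hCne : (closure K).Nonempty := hne.closure
  have hcont : Continuous (fun c => sSup ((fun x => dist c x) '' closure K)) :=
    hC.continuous_sSup (f := fun c x => dist c x) (by fun_prop)
  have hle : ∀ c, ∀ x ∈ closure K, dist c x ≤ sSup ((fun x => dist c x) '' closure K) := by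
    intro c x hx
    exact le_csSup (hC.image (by fun_prop)).bddAbove ⟨x, hx, rfl⟩
  have hex : ∀ c, ∃ x ∈ closure K, sSup ((fun x => dist c x) '' closure K) = dist c x := by
    intro c
    exact hC.exists_sSup_image_eq hCne (by fun_prop)
  obtain ⟨z, hz⟩ := hCne
  obtain ⟨c, hc⟩ := hcont.exists_forall_le
    (Filter.tendsto_atTop_mono (fun c => hle c z hz) (tendsto_dist_right_cocompact_atTop z))
  obtain ⟨y, hy, hyR⟩ := hex c
  have key : ∀ t : ℝ, 0 < t → t ≤ 1 → (2 - t) * dist c y ^ 2 ≤ Metric.diam K ^ 2 := by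
    intro t ht ht1
    obtain ⟨x, hx, hxR⟩ := hex (c + t • (y - c))
    have h1 : dist c y ≤ dist (c + t • (y - c)) x := by
      rw [← hyR, ← hxR]; exact hc _
    have h2 : dist c x ≤ dist c y := by
      rw [← hyR]; exact hle c x hx
    have h3 : dist x y ≤ Metric.diam K := by
      rw [← Metric.diam_closure]
      exact Metric.dist_le_diam_of_mem hbdd.closure hx hy
    have e1 : dist (c + t • (y - c)) x = ‖(x - c) - t • (y - c)‖ := by
      rw [dist_comm, dist_eq_norm]; congr 1; abel
    have e2 : dist x y = ‖(x - c) - (y - c)‖ := by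
      rw [dist_eq_norm]; congr 1; abel
    have e3 : dist c x = ‖x - c‖ := by rw [dist_comm, dist_eq_norm]
    have e4 : dist c y = ‖y - c‖ := by rw [dist_comm, dist_eq_norm]
    rw [e1, e4] at h1
    rw [e3, e4] at h2
    rw [e2] at h3
    rw [e4]
    generalize x - c = v at *
    generalize y - c = u at *
    have h1' := pow_le_pow_left₀ (norm_nonneg _) h1 2
    have h2' := pow_le_pow_left₀ (norm_nonneg _) h2 2
    have h3' := pow_le_pow_left₀ (norm_nonneg _) h3 2
    rw [norm_sub_sq_real, inner_smul_right, norm_smul, mul_pow, Real.norm_eq_abs, sq_abs] at h1'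
    rw [norm_sub_sq_real] at h3'
    have h4 : 2 * inner ℝ v u ≤ t * ‖u‖ ^ 2 := by
      have : t * (2 * inner ℝ v u) ≤ t * (t * ‖u‖ ^ 2) := by nlinarith
      exact le_of_mul_le_mul_left this ht
    have h5 := mul_le_mul_of_nonneg_left h4 (sub_nonneg.2 ht1)
    nlinarith
  have fin : 2 * dist c y ^ 2 ≤ Metric.diam K ^ 2 := by
    have hT : Filter.Tendsto (fun t : ℝ => (2 - t) * dist c y ^ 2) (nhdsWithin 0 (Set.Ioi 0))
        (nhds ((2 - 0) * dist c y ^ 2)) :=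
      (Continuous.tendsto (by fun_prop) 0).mono_left nhdsWithin_le_nhds
    rw [sub_zero] at hT
    refine le_of_tendsto hT ?_
    filter_upwards [Ioc_mem_nhdsGT (zero_lt_one' ℝ)] with t ht
    exact key t ht.1 ht.2
  refine ⟨c, fun x hx => ?_⟩
  rw [Metric.mem_closedBall, dist_comm]
  have h := hle c x (subset_closure hx)
  rw [hyR] at h
  refine h.trans ?_
  rw [le_div_iff₀ (by positivity)]
  refine abs_le_of_sq_le_sq' ?_ Metric.diam_nonneg |>.2
  rw [mul_pow, Real.sq_sqrt (by norm_num)]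
  linarith
end

section
/- Let d ≥ 1 and let K be a nonempty compact subset of ℝ^d with diam(K) > 0 for which Jung's inequality is an equality, i.e., meb(K) = √(d/(2(d+1))) · diam(K), where meb(K) := ⨅_{c ∈ ℝ^d} sup_{x ∈ K} dist(c, x). Then K contains d+1 points that are pairwise at distance exactly diam(K); that is, equality in Jung's bound is attained precisely by sets containing the vertices of a regular d-simplex of edge length diam(K). -/
lemma jung_aux_compact {E : Type*} [NormedAddCommGroup E] [NormedSpace ℝ E]
    [FiniteDimensional ℝ E] (K : Set E) (hK : IsCompact K) :
    IsCompact (convexHull ℝ K) := by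
  rcases K.eq_empty_or_nonempty with rfl | ⟨k0, hk0⟩
  · simp
  set n := Module.finrank ℝ E + 1 with hn
  have hC : IsCompact (stdSimplex ℝ (Fin n) ×ˢ Set.pi Set.univ (fun _ : Fin n => K)) :=
    (isCompact_stdSimplex ℝ (Fin n)).prod (isCompact_univ_pi fun _ => hK)
  have hc : Continuous (fun p : (Fin n → ℝ) × (Fin n → E) => ∑ i, p.1 i • p.2 i) := by fun_prop
  convert hC.image hc using 1
  ext x
  constructor
  · intro hx
    obtain ⟨ι, _, z, w, hz, hai, hw0, hw1, hwz⟩ := eq_pos_convex_span_of_mem_convexHull hx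
    have hcard : Fintype.card ι ≤ Fintype.card (Fin n) := by
      have := hai.card_le_finrank_succ
      have h2 := Submodule.finrank_le (vectorSpan ℝ (Set.range z))
      rw [Fintype.card_fin]
      omega
    obtain ⟨e⟩ := Function.Embedding.nonempty_of_card_le hcard
    have hout : ∀ j, j ∉ Set.range e → Function.extend e w 0 j = 0 := by
      intro j hj
      rw [Function.extend_apply' _ _ _ (fun h => hj h)]; rfl
    refine ⟨(Function.extend e w 0, Function.extend e z (fun _ => k0)), ⟨⟨?_, ?_⟩, ?_⟩, ?_⟩
    · intro j
      by_cases hj : j ∈ Set.range e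
      · obtain ⟨i, rfl⟩ := hj
        simpa [e.injective.extend_apply] using (hw0 i).le
      · exact (hout j hj).ge
    · rw [← hw1]
      refine (Fintype.sum_of_injective e e.injective _ _ hout fun i => ?_).symm
      rw [e.injective.extend_apply]
    · intro j _
      by_cases hj : j ∈ Set.range e
      · obtain ⟨i, rfl⟩ := hj
        simpa [e.injective.extend_apply] using hz ⟨i, rfl⟩
      · simpa [Function.extend_apply' _ _ _ (fun h => hj h)] using hk0
    · rw [← hwz]
      refine (Fintype.sum_of_injective e e.injective _ _ (fun j hj => ?_) fun i => ?_).symm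
      · simp [hout j hj]
      · simp [e.injective.extend_apply]
  · rintro ⟨⟨w, z⟩, ⟨⟨hw0, hw1⟩, hz⟩, rfl⟩
    exact (convex_convexHull ℝ _).sum_mem (fun i _ => hw0 i) hw1
      (fun i _ => subset_convexHull ℝ _ (hz i (Set.mem_univ i)))

lemma jung_aux_max {E : Type*} [NormedAddCommGroup E] [InnerProductSpace ℝ E]
    [FiniteDimensional ℝ E] (K : Set E) (hne : K.Nonempty) (hK : IsCompact K) :
    ∃ (y : E) (V : ℝ), 0 ≤ V ∧ (∀ x ∈ K, ‖x - y‖ ^ 2 ≤ V) ∧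
      y ∈ convexHull ℝ {x ∈ K | ‖x - y‖ ^ 2 = V} := by
  set f : E → E × ℝ := fun x => (x, ‖x‖ ^ 2) with hf
  have hfc : Continuous f := by fun_prop
  have hS : IsCompact (convexHull ℝ (f '' K)) := jung_aux_compact _ (hK.image hfc)
  have hSne : (convexHull ℝ (f '' K)).Nonempty := (hne.image f).convexHull
  have hg : Continuous (fun p : E × ℝ => p.2 - ‖p.1‖ ^ 2) := by fun_prop
  obtain ⟨⟨y, s⟩, hys, hmax⟩ := hS.exists_isMaxOn hSne hg.continuousOn
  have key : ∀ x ∈ K, ‖x - y‖ ^ 2 ≤ s - ‖y‖ ^ 2 := by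
    intro x hx
    by_contra! hlt
    have hconv := convex_convexHull ℝ (f '' K)
    have hfx : f x ∈ convexHull ℝ (f '' K) := subset_convexHull ℝ _ ⟨x, hx, rfl⟩
    have h1 : ∀ t : ℝ, 0 < t → t ≤ 1 →
        ‖x - y‖ ^ 2 - (s - ‖y‖ ^ 2) ≤ t * ‖x - y‖ ^ 2 := by
      intro t ht ht1
      have hm := hmax (hconv hys hfx (by linarith : (0:ℝ) ≤ 1 - t) ht.le (by ring))
      simp only [hf, Set.mem_ofPred_eq, Prod.fst_add, Prod.snd_add, Prod.smul_fst,
        Prod.smul_snd, smul_eq_mul] at hm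
      have e1 : (1 - t) • y + t • x = y + t • (x - y) := by module
      have e2 : ‖x‖ ^ 2 = ‖y‖ ^ 2 + 2 * inner ℝ y (x - y) + ‖x - y‖ ^ 2 := by
        rw [← norm_add_sq_real]; simp
      rw [e1, norm_add_sq_real, norm_smul, inner_smul_right, mul_pow, Real.norm_eq_abs,
        sq_abs, e2] at hm
      nlinarith
    set a := ‖x - y‖ ^ 2 - (s - ‖y‖ ^ 2) with ha
    have ha0 : 0 < a := by linarith
    set b := ‖x - y‖ ^ 2 with hb
    have hb0 : 0 ≤ b := by positivity
    have h2 := h1 (a / (a + b + 1)) (by positivity) (by rw [div_le_one (by positivity)]; linarith)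
    rw [div_mul_eq_mul_div, le_div_iff₀ (by positivity)] at h2
    nlinarith
  obtain ⟨ι, _, z, w, hz, -, hw0, hw1, hwz⟩ := eq_pos_convex_span_of_mem_convexHull hys
  have hx : ∀ i, ∃ x ∈ K, f x = z i := fun i => hz ⟨i, rfl⟩
  choose x hxK hxz using hx
  have hy : ∑ i, w i • x i = y := by
    have := congrArg Prod.fst hwz
    simpa [Prod.fst_sum, ← hxz, hf] using this
  have hs : ∑ i, w i * ‖x i‖ ^ 2 = s := by
    have := congrArg Prod.snd hwz
    simpa [Prod.snd_sum, ← hxz, hf] using this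
  have hsum : ∑ i, w i * ((s - ‖y‖ ^ 2) - ‖x i - y‖ ^ 2) = 0 := by
    have hin : ∑ i, w i * inner ℝ (x i) y = ‖y‖ ^ 2 := by
      rw [← real_inner_self_eq_norm_sq]
      have h : inner ℝ (∑ i, w i • x i) y = inner ℝ y y := by rw [hy]
      rw [← h, sum_inner]
      simp [inner_smul_left]
    have : ∀ i, w i * ((s - ‖y‖ ^ 2) - ‖x i - y‖ ^ 2) =
        w i * (s - 2 * ‖y‖ ^ 2) - w i * ‖x i‖ ^ 2 + 2 * (w i * inner ℝ (x i) y) := by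
      intro i; rw [norm_sub_sq_real]; ring
    simp only [this, Finset.sum_add_distrib, Finset.sum_sub_distrib, ← Finset.sum_mul,
      ← Finset.mul_sum, hw1, hs, hin]
    ring
  have hz0 := (Finset.sum_eq_zero_iff_of_nonneg (fun i _ =>
    mul_nonneg (hw0 i).le (sub_nonneg.2 (key (x i) (hxK i))))).1 hsum
  refine ⟨y, s - ‖y‖ ^ 2, ?_, key, ?_⟩
  · obtain ⟨x0, hx0⟩ := hne
    exact (by positivity : (0:ℝ) ≤ ‖x0 - y‖ ^ 2).trans (key x0 hx0)
  · have : ∑ i, w i • x i ∈ convexHull ℝ {x ∈ K | ‖x - y‖ ^ 2 = s - ‖y‖ ^ 2} := by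
      refine (convex_convexHull ℝ _).sum_mem (fun i _ => (hw0 i).le) hw1 (fun i _ => ?_)
      refine subset_convexHull ℝ _ ⟨hxK i, ?_⟩
      have := (mul_eq_zero.1 (hz0 i (Finset.mem_univ i))).resolve_left (hw0 i).ne'
      linarith
    rwa [hy] at this

theorem jung_equality_case (d : ℕ) (hd : 1 ≤ d)
    (K : Set (EuclideanSpace ℝ (Fin d))) (hne : K.Nonempty) (hK : IsCompact K)
    (hdiam : 0 < Metric.diam K)
    (heq : (⨅ c : EuclideanSpace ℝ (Fin d), ⨆ x ∈ K, dist c x) =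
      Real.sqrt ((d : ℝ) / (2 * ((d : ℝ) + 1))) * Metric.diam K) :
    ∃ p : Fin (d + 1) → EuclideanSpace ℝ (Fin d),
      (∀ i, p i ∈ K) ∧ ∀ i j, i ≠ j → dist (p i) (p j) = Metric.diam K := by
  obtain ⟨y, V, hV0, hV, hy⟩ := jung_aux_max K hne hK
  set D := Metric.diam K with hD
  have hR : (d : ℝ) / (2 * ((d : ℝ) + 1)) * D ^ 2 ≤ V := by
    have h1 : Real.sqrt ((d : ℝ) / (2 * ((d : ℝ) + 1))) * D ≤ Real.sqrt V := by
      rw [← heq]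
      refine (ciInf_le ⟨0, ?_⟩ y).trans ?_
      · rintro _ ⟨c, rfl⟩
        exact Real.iSup_nonneg fun x => Real.iSup_nonneg fun _ => dist_nonneg
      · refine Real.iSup_le (fun x => Real.iSup_le (fun hx => ?_) (Real.sqrt_nonneg _))
          (Real.sqrt_nonneg _)
        rw [dist_comm, dist_eq_norm]
        exact Real.le_sqrt_of_sq_le (hV x hx)
    have h2 := pow_le_pow_left₀ (by positivity) h1 2
    rwa [mul_pow, Real.sq_sqrt (by positivity), Real.sq_sqrt hV0] at h2
  obtain ⟨ι, _, z, w, hz, hai, hw0, hw1, hwz⟩ := eq_pos_convex_span_of_mem_convexHull hy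
  have hzA : ∀ i, z i ∈ K ∧ ‖z i - y‖ ^ 2 = V := fun i => hz ⟨i, rfl⟩
  have hcard : Fintype.card ι ≤ d + 1 := by
    have := hai.card_le_finrank_succ
    have h2 := Submodule.finrank_le (vectorSpan ℝ (Set.range z))
    rw [finrank_euclideanSpace_fin] at h2
    omega
  have hdist : ∀ i j, ‖z i - z j‖ ≤ D := fun i j => by
    rw [← dist_eq_norm]
    exact Metric.dist_le_diam_of_mem hK.isBounded (hzA i).1 (hzA j).1
  -- the double sum
  have hin : ∑ i, ∑ j, w i * w j * inner ℝ (z i - y) (z j - y) = 0 := by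
    have h0 : ∑ i, w i • (z i - y) = 0 := by
      simp only [smul_sub, Finset.sum_sub_distrib, ← Finset.sum_smul, hw1, hwz, one_smul, sub_self]
    have : inner ℝ (∑ i, w i • (z i - y)) (∑ j, w j • (z j - y)) = 0 := by rw [h0]; simp
    rw [sum_inner] at this
    simp only [inner_sum, inner_smul_left, inner_smul_right] at this
    rw [← this]
    refine Finset.sum_congr rfl fun i _ => Finset.sum_congr rfl fun j _ => ?_
    simp; ring
  have hww : ∑ i, ∑ j, w i * w j = 1 := by
    simp [← Finset.mul_sum, hw1]
  have hdd : ∑ i, ∑ j, w i * w j * ‖z i - z j‖ ^ 2 = 2 * V := by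
    have : ∀ i j, w i * w j * ‖z i - z j‖ ^ 2 =
        2 * V * (w i * w j) - 2 * (w i * w j * inner ℝ (z i - y) (z j - y)) := by
      intro i j
      rw [← sub_sub_sub_cancel_right (z i) (z j) y, norm_sub_sq_real, (hzA i).2, (hzA j).2]
      ring
    simp only [this, Finset.sum_sub_distrib, ← Finset.mul_sum, hin]
    simp only [← Finset.mul_sum, hw1, mul_one, hww]
    ring
  classical
  set T : ι → ι → ℝ := fun i j => if i = j then 0 else w i * w j * (D ^ 2 - ‖z i - z j‖ ^ 2) with hT
  have hT0 : ∀ i j, 0 ≤ T i j := by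
    intro i j
    simp only [hT]
    split_ifs
    · exact le_rfl
    · exact mul_nonneg (mul_nonneg (hw0 i).le (hw0 j).le)
        (sub_nonneg.2 (pow_le_pow_left₀ (norm_nonneg _) (hdist i j) 2))
  have hTs : ∑ i, ∑ j, T i j = D ^ 2 - 2 * V - D ^ 2 * ∑ i, w i ^ 2 := by
    have : ∀ i j, T i j = D ^ 2 * (w i * w j) - w i * w j * ‖z i - z j‖ ^ 2
        - D ^ 2 * (if i = j then w i ^ 2 else 0) := by
      intro i j
      simp only [hT]
      split_ifs with h
      · subst h; simp; ring
      · ring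
    simp only [this, Finset.sum_sub_distrib, ← Finset.mul_sum, hdd]
    simp [← Finset.mul_sum, hw1]
  have hTn : 0 ≤ ∑ i, ∑ j, T i j :=
    Finset.sum_nonneg fun i _ => Finset.sum_nonneg fun j _ => hT0 i j
  have hcs : 1 ≤ (Fintype.card ι : ℝ) * ∑ i, w i ^ 2 := by
    have := sq_sum_le_card_mul_sum_sq (s := Finset.univ) (f := w)
    rw [hw1] at this
    simpa using this
  set Q := ∑ i, w i ^ 2 with hQ
  have hD2 : 0 < D ^ 2 := by positivity
  have hd1 : (0:ℝ) < d + 1 := by positivity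
  have hQ0 : 0 < Q := by
    by_contra! h
    have : (Fintype.card ι : ℝ) * Q ≤ 0 := mul_nonpos_of_nonneg_of_nonpos (by positivity) h
    linarith
  have hcR : (Fintype.card ι : ℝ) ≤ d + 1 := by exact_mod_cast hcard
  have hV2 : D ^ 2 - 2 * V ≤ D ^ 2 / (d + 1) := by
    have : D ^ 2 - 2 * ((d : ℝ) / (2 * ((d : ℝ) + 1)) * D ^ 2) = D ^ 2 / (d + 1) := by
      field_simp; ring
    linarith
  have hQ1 : 1 ≤ (d + 1) * Q := hcs.trans (by gcongr)
  have hQ2 : D ^ 2 / (d + 1) ≤ D ^ 2 * Q := by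
    rw [div_le_iff₀ hd1]; nlinarith
  have hQ3 : D ^ 2 * Q ≤ D ^ 2 / (d + 1) := by linarith
  have hcard' : Fintype.card ι = d + 1 := by
    refine le_antisymm hcard ?_
    rw [le_div_iff₀ hd1, mul_assoc] at hQ3
    have h4 : Q * (d + 1) ≤ 1 := by
      by_contra! h; nlinarith
    have h5 : (d + 1 : ℝ) ≤ Fintype.card ι := by
      have : Q * (d + 1) ≤ Q * Fintype.card ι := by linarith
      exact le_of_mul_le_mul_left this hQ0
    exact_mod_cast h5
  have hTz : ∑ i, ∑ j, T i j = 0 := le_antisymm (by linarith) hTn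
  have hTij : ∀ i j, T i j = 0 := by
    intro i j
    have h1 := (Finset.sum_eq_zero_iff_of_nonneg (fun i _ =>
      Finset.sum_nonneg fun j _ => hT0 i j)).1 hTz i (Finset.mem_univ i)
    exact (Finset.sum_eq_zero_iff_of_nonneg (fun j _ => hT0 i j)).1 h1 j (Finset.mem_univ j)
  let e : Fin (d + 1) ≃ ι := (Fintype.equivFinOfCardEq hcard').symm
  refine ⟨fun i => z (e i), fun i => (hzA _).1, fun i j hij => ?_⟩
  have h := hTij (e i) (e j)
  simp only [hT, if_neg (e.injective.ne hij)] at h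
  have h2 := (mul_eq_zero.1 h).resolve_left (mul_pos (hw0 _) (hw0 _)).ne'
  rw [dist_eq_norm]
  exact (pow_left_inj₀ (norm_nonneg _) hdiam.le two_ne_zero).1 (by linarith)
end
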